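/- Let b ∈ ℝ, σ > 0, and let Π be a σ-finite positive measure on ℝ with Π({0}) = 0, Π((0,∞)) = 0, ∫ min(1,r²) dΠ(r) < ∞, and set Ψ(u) = bu + σ²u²/2 + ∫_{−∞}^0 (e^{ur} − 1 − ur·1_{{|r|≤1}}) dΠ(r) for u ≥ 0, so that Ψ'(y) = b + σ²y + ∫_{−∞}^0 (e^{yr} − 1_{{|r|≤1}})·r dΠ(r). Fix t > 0 and let μ be a probability measure on ℝ satisfying ∫_ℝ e^{uy} dμ(y) = e^{tΨ(u)} for all u ≥ 0. Then μ is absolutely continuous with a continuous density f_t, and as y → ∞, f_t(t·Ψ'(y)) ∼ (2πσ²t)^{−1/2}·exp(−tσ²y²/2 + t·y²·∫_{−∞}^0 e^{yr}·r·Π((−∞,r)) dr), i.e. the ratio of the two sides tends to 1. -/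

import Mathlib

open MeasureTheory Set Filter

noncomputable section

/-- `G` is asymptotically parabolic on the interval `(a, ∞)` (with `a ∈ [-∞, ∞)` an
extended real): `G` is twice continuously differentiable there, `G'' > 0` there, and
`G''(u + w (G''(u))^{-1/2}) / G''(u) → 1` as `u → ∞` locally uniformly in `w`. -/
def AsympParabolic (a : EReal) (G : ℝ → ℝ) : Prop :=
  a < ⊤ ∧
  ContDiffOn ℝ 2 G {u : ℝ | a < (u : EReal)} ∧
  (∀ u : ℝ, a < (u : EReal) → 0 < deriv (deriv G) u) ∧
  ∀ W > (0:ℝ), ∀ ε > (0:ℝ), ∃ U : ℝ, ∀ u ≥ U, ∀ w : ℝ, |w| ≤ W →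
    |deriv (deriv G) (u + w * (deriv (deriv G) u) ^ (-(1:ℝ)/2)) / deriv (deriv G) u - 1| < ε

/-- An asymptotically parabolic function is admissible if `G(x)/x → ∞`. -/
def AdmissibleAP (a : EReal) (G : ℝ → ℝ) : Prop :=
  AsympParabolic a G ∧ Tendsto (fun x => G x / x) atTop atTop

/-- The `n`-th moment of a measure `ν` (supported on `[0,∞)`). -/
def Mnu (ν : Measure ℝ) (n : ℕ) : ℝ := ∫ x, x ^ n ∂ν

/-- The complex moment transform `z ↦ ∫₀^∞ x^z dν(x)`. -/
def Mc (ν : Measure ℝ) (z : ℂ) : ℂ := ∫ x in Ioi (0:ℝ), (x : ℂ) ^ z ∂ν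

/-- The real moment transform `u ↦ ∫₀^∞ x^u dν(x)`. -/
def Mr (ν : Measure ℝ) (u : ℝ) : ℝ := ∫ x in Ioi (0:ℝ), x ^ u ∂ν

/-- `η(n) = ((log M_ν)''(n))^{1/2}`. -/
def eta (ν : Measure ℝ) (n : ℕ) : ℝ :=
  Real.sqrt (deriv (deriv fun u : ℝ => Real.log (Mr ν u)) (n : ℝ))

/-- The (topological) support of `ν` is exactly `[0, ∞)`. -/
def SupportIsIci (ν : Measure ℝ) : Prop :=
  ν (Iio (0:ℝ)) = 0 ∧ ∀ x : ℝ, 0 ≤ x → ∀ ε > (0:ℝ), 0 < ν (Ioo (x - ε) (x + ε))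

/-- `ν` is moment determinate: any nonnegative Borel measure on `[0,∞)` with the same
(finite) moment sequence equals `ν`. -/
def MomentDeterminate (ν : Measure ℝ) : Prop :=
  ∀ μ : Measure ℝ, μ (Iio (0:ℝ)) = 0 → (∀ n : ℕ, Integrable (fun x => x ^ n) μ) →
    (∀ n : ℕ, Mnu μ n = Mnu ν n) → μ = ν

/-- `ν` is moment indeterminate. -/
def MomentIndeterminate (ν : Measure ℝ) : Prop := ¬ MomentDeterminate ν

theorem integral_schwartz_eq_integral_mul_fourier_charFun
    (ν : Measure ℝ) [IsFiniteMeasure ν] (hν : Integrable (charFun ν))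
    (φ : SchwartzMap ℝ ℂ) :
    ∫ x, φ x ∂ν = ∫ x, φ x * ((2 * Real.pi)⁻¹ * ∫ s : ℝ, Complex.exp (-(s * x * Complex.I)) * charFun ν s) := by
  have hC : Integrable (fun v : ℝ => charFun ν (-(2 * Real.pi) * v)) :=
    hν.comp_mul_left' (by simp [Real.pi_ne_zero])
  have h1 : ∫ x, φ x ∂ν =
      ∫ v, (FourierTransformInv.fourierInv φ) v * charFun ν (-(2 * Real.pi) * v) := by
    have := VectorFourier.integral_fourierIntegral_smul_eq_flip (μ := (volume : Measure ℝ)) (ν := ν)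
      (e := Real.fourierChar) (L := innerₗ ℝ) (f := (FourierTransformInv.fourierInv φ))
      (g := fun _ => (1 : ℂ)) Real.continuous_fourierChar (by fun_prop)
      (SchwartzMap.integrable _) (integrable_const _)
    convert this using 1
    · congr 1; ext x
      conv_lhs => rw [← FourierTransform.fourier_fourierInv_eq (F := SchwartzMap ℝ ℂ) φ]
      rw [smul_eq_mul, mul_one]
      rfl
    · congr 1; ext v
      rw [smul_eq_mul, charFun_apply_real]
      congr 1
      simp only [VectorFourier.fourierIntegral]
      congr 1; ext x
      simp [Circle.smul_def, Real.fourierChar_apply]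
      ring_nf
  have h2 : ∫ v, (FourierTransformInv.fourierInv φ) v * charFun ν (-(2 * Real.pi) * v) =
      ∫ x, φ x * ∫ v : ℝ, Complex.exp (2 * Real.pi * v * x * Complex.I) *
        charFun ν (-(2 * Real.pi) * v) := by
    have := VectorFourier.integral_fourierIntegral_smul_eq_flip (μ := (volume : Measure ℝ))
      (ν := (volume : Measure ℝ))
      (e := Real.fourierChar) (L := -innerₗ ℝ) (f := φ)
      (g := fun v => charFun ν (-(2 * Real.pi) * v)) Real.continuous_fourierChar
      (by simp; fun_prop)
      (SchwartzMap.integrable _) hC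
    convert this using 1
    · congr 1; ext v
      rw [smul_eq_mul, SchwartzMap.fourierInv_coe, Real.fourierInv_eq]
      simp [VectorFourier.fourierIntegral]
    · congr 1; ext x
      rw [smul_eq_mul]
      congr 1
      simp only [VectorFourier.fourierIntegral]
      congr 1; ext v
      simp [Circle.smul_def, Real.fourierChar_apply]
      left
      ring_nf
  rw [h1, h2]
  congr 1; ext x
  congr 1
  have := Measure.integral_comp_mul_left
    (fun s : ℝ => Complex.exp (-(s * x * Complex.I)) * charFun ν s) (-(2 * Real.pi))
  have h3 : |(-(2 * Real.pi))⁻¹| = (2 * Real.pi)⁻¹ := by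
    rw [abs_inv, abs_neg, abs_of_pos Real.two_pi_pos]
  rw [h3, Complex.real_smul] at this
  rw [← this]
  congr 1; ext v
  congr 2
  push_cast
  ring

/-- The inverse Fourier transform of the characteristic function of a measure. -/
def charFunDensity (ν : Measure ℝ) (x : ℝ) : ℝ :=
  ((2 * Real.pi)⁻¹ * ∫ s : ℝ, Complex.exp (-(s * x * Complex.I)) * charFun ν s).re

theorem continuous_fourier_charFun {ν : Measure ℝ} (hν : Integrable (charFun ν)) :
    Continuous fun x : ℝ => ((2 * Real.pi)⁻¹ *
      ∫ s : ℝ, Complex.exp (-(s * x * Complex.I)) * charFun ν s : ℂ) := by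
  refine continuous_const.mul (continuous_of_dominated (bound := fun s => ‖charFun ν s‖) ?_ ?_
    hν.norm ?_)
  · intro x
    exact (Continuous.aestronglyMeasurable (by fun_prop)).mul hν.aestronglyMeasurable
  · intro x
    refine .of_forall fun s => ?_
    rw [norm_mul, show -((s : ℂ) * x * Complex.I) = ((-(s * x) : ℝ) : ℂ) * Complex.I by push_cast; ring,
      Complex.norm_exp_ofReal_mul_I, one_mul]
  · refine .of_forall fun s => ?_
    fun_prop

theorem continuous_charFunDensity {ν : Measure ℝ} (hν : Integrable (charFun ν)) :
    Continuous (charFunDensity ν) :=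
  Complex.continuous_re.comp (continuous_fourier_charFun hν)

theorem integral_smooth_eq_integral_mul_charFunDensity
    (ν : Measure ℝ) [IsFiniteMeasure ν] (hν : Integrable (charFun ν))
    (φ : ℝ → ℝ) (hφ : ContDiff ℝ ((⊤ : ℕ∞) : WithTop ℕ∞) φ) (hc : HasCompactSupport φ) :
    ∫ x, φ x ∂ν = ∫ x, φ x * charFunDensity ν x := by
  have hc' : HasCompactSupport (fun x => (φ x : ℂ)) := hc.comp_left (g := Complex.ofReal) rfl
  have h := integral_schwartz_eq_integral_mul_fourier_charFun ν hν
    (hc'.toSchwartzMap (Complex.ofRealCLM.contDiff.comp hφ))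
  change ∫ x, (φ x : ℂ) ∂ν = ∫ x, (φ x : ℂ) * ((2 * Real.pi)⁻¹ *
    ∫ s : ℝ, Complex.exp (-(s * x * Complex.I)) * charFun ν s : ℂ) at h
  have hint : Integrable fun x : ℝ => (φ x : ℂ) * ((2 * Real.pi)⁻¹ *
      ∫ s : ℝ, Complex.exp (-(s * x * Complex.I)) * charFun ν s) :=
    ((Complex.continuous_ofReal.comp hφ.continuous).mul
      (continuous_fourier_charFun hν)).integrable_of_hasCompactSupport hc'.mul_right
  have h' := congrArg Complex.re h
  rw [integral_complex_ofReal, Complex.ofReal_re] at h'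
  rw [← RCLike.re_eq_complex_re, ← integral_re hint] at h'
  rw [h']
  congr 1; ext x
  exact Complex.re_ofReal_mul _ _

theorem measureReal_ball_eq_integral_charFunDensity
    (ν : Measure ℝ) [IsFiniteMeasure ν] (hν : Integrable (charFun ν)) (c R : ℝ) (hR : 0 < R) :
    ν.real (Metric.ball c R) = ∫ x in Metric.ball c R, charFunDensity ν x := by
  have hlt : ∀ n : ℕ, R * (1 - 1 / ((n : ℝ) + 2)) < R := fun n => by
    have : 0 < 1 / ((n : ℝ) + 2) := by positivity
    nlinarith
  have hpos : ∀ n : ℕ, 0 < R * (1 - 1 / ((n : ℝ) + 2)) := fun n => by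
    have : 1 / ((n : ℝ) + 2) < 1 := by
      rw [div_lt_one (by positivity)]; linarith [(Nat.cast_nonneg n : (0:ℝ) ≤ n)]
    apply mul_pos hR; linarith
  let φ : ℕ → ContDiffBump c := fun n => ⟨_, R, hpos n, hlt n⟩
  have hlim : ∀ x, Tendsto (fun n => φ n x) atTop
      (nhds ((Metric.ball c R).indicator (fun _ => (1:ℝ)) x)) := by
    intro x
    by_cases hx : x ∈ Metric.ball c R
    · rw [indicator_of_mem hx]
      refine tendsto_const_nhds.congr' ?_
      have ht : Tendsto (fun n : ℕ => R * (1 - 1 / ((n : ℝ) + 2))) atTop (nhds R) := by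
        have : Tendsto (fun n : ℕ => 1 / ((n : ℝ) + 2)) atTop (nhds 0) := by
          have h0 := (tendsto_add_atTop_iff_nat (f := fun n : ℕ => 1 / (n : ℝ)) 2).2
            tendsto_one_div_atTop_nhds_zero_nat
          simpa using h0
        simpa using (this.const_sub 1).const_mul R
      filter_upwards [ht.eventually (lt_mem_nhds (Metric.mem_ball.1 hx))] with n hn
      exact ((φ n).one_of_mem_closedBall (Metric.mem_closedBall.2 hn.le)).symm
    · rw [indicator_of_notMem hx]
      refine tendsto_const_nhds.congr fun n => ?_
      exact ((φ n).zero_of_le_dist (by simpa using hx)).symm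
  have h1 : Tendsto (fun n => ∫ x, φ n x ∂ν) atTop (nhds (ν.real (Metric.ball c R))) := by
    rw [← integral_indicator_one Metric.isOpen_ball.measurableSet]
    refine tendsto_integral_of_dominated_convergence (fun _ => 1) ?_ (integrable_const _) ?_ ?_
    · exact fun n => (φ n).continuous.aestronglyMeasurable
    · exact fun n => .of_forall fun x => by
        rw [Real.norm_of_nonneg (φ n).nonneg]; exact (φ n).le_one
    · exact .of_forall hlim
  have h2 : Tendsto (fun n => ∫ x, φ n x * charFunDensity ν x) atTop
      (nhds (∫ x in Metric.ball c R, charFunDensity ν x)) := by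
    rw [← integral_indicator Metric.isOpen_ball.measurableSet]
    refine tendsto_integral_of_dominated_convergence
      ((Metric.closedBall c R).indicator fun x => |charFunDensity ν x|) ?_ ?_ ?_ ?_
    · exact fun n => ((φ n).continuous.mul (continuous_charFunDensity hν)).aestronglyMeasurable
    · exact ((continuous_charFunDensity hν).abs.continuousOn.integrableOn_compact
        (isCompact_closedBall c R)).integrable_indicator Metric.isClosed_closedBall.measurableSet
    · refine fun n => .of_forall fun x => ?_
      rw [norm_mul, Real.norm_of_nonneg (φ n).nonneg, Real.norm_eq_abs]
      by_cases hx : x ∈ Metric.closedBall c R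
      · rw [indicator_of_mem hx]
        exact mul_le_of_le_one_left (abs_nonneg _) (φ n).le_one
      · rw [indicator_of_notMem hx, (φ n).zero_of_le_dist, zero_mul]
        simp at hx; exact hx.le
    · refine .of_forall fun x => ?_
      convert (hlim x).mul_const (charFunDensity ν x) using 2
      by_cases hx : x ∈ Metric.ball c R <;> simp [hx]
  refine tendsto_nhds_unique h1 (h2.congr fun n => ?_)
  exact (integral_smooth_eq_integral_mul_charFunDensity ν hν _ (φ n).contDiff
    (φ n).hasCompactSupport).symm

theorem charFunDensity_nonneg
    (ν : Measure ℝ) [IsFiniteMeasure ν] (hν : Integrable (charFun ν)) (x : ℝ) :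
    0 ≤ charFunDensity ν x := by
  by_contra! hx
  obtain ⟨R, hR, hball⟩ := Metric.isOpen_iff.1
    (isOpen_lt (continuous_charFunDensity hν) continuous_const) x hx
  have h := measureReal_ball_eq_integral_charFunDensity ν hν x R hR
  have hi : IntegrableOn (charFunDensity ν) (Metric.ball x R) :=
    ((continuous_charFunDensity hν).continuousOn.integrableOn_compact
        (isCompact_closedBall x R)).mono_set Metric.ball_subset_closedBall
  have h3 : 0 < ∫ y in Metric.ball x R, -charFunDensity ν y := by
    rw [setIntegral_pos_iff_support_of_nonneg_ae]
    · have : Function.support (fun y => -charFunDensity ν y) ∩ Metric.ball x R =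
          Metric.ball x R := inter_eq_right.2 fun y hy => by
        have : charFunDensity ν y < 0 := hball hy
        simp [this.ne]
      rw [this]
      exact Metric.measure_ball_pos _ _ hR
    · filter_upwards [ae_restrict_mem Metric.isOpen_ball.measurableSet] with y hy
      have : charFunDensity ν y < 0 := hball hy
      simp [this.le]
    · exact hi.neg
  rw [integral_neg, ← h] at h3
  linarith [measureReal_nonneg (μ := ν) (s := Metric.ball x R)]

theorem eq_withDensity_charFunDensity
    (ν : Measure ℝ) [IsFiniteMeasure ν] (hν : Integrable (charFun ν)) :
    ν = volume.withDensity fun x => ENNReal.ofReal (charFunDensity ν x) := by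
  refine Real.measure_ext_Ioo_rat fun a b => ?_
  rcases le_or_gt (b : ℝ) a with hab | hab
  · simp [Ioo_eq_empty_of_le hab]
  have hb : Ioo (a : ℝ) b = Metric.ball (((a : ℝ) + b) / 2) (((b : ℝ) - a) / 2) := by
    rw [Real.ball_eq_Ioo]; congr 1 <;> ring
  rw [hb, withDensity_apply _ Metric.isOpen_ball.measurableSet,
    ← ofReal_integral_eq_lintegral_ofReal,
    ← measureReal_ball_eq_integral_charFunDensity ν hν _ _ (by linarith), ofReal_measureReal]
  · exact ((continuous_charFunDensity hν).continuousOn.integrableOn_compact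
        (isCompact_closedBall _ _)).mono_set Metric.ball_subset_closedBall
  · exact .of_forall fun x => charFunDensity_nonneg ν hν x

theorem norm_exp_sub_one_le_of_re_nonpos {w : ℂ} (hw : w.re ≤ 0) :
    ‖Complex.exp w - 1‖ ≤ 2 * ‖w‖ := by
  rcases le_or_gt ‖w‖ 1 with h | h
  · exact Complex.norm_exp_sub_one_le h
  · have h1 : ‖Complex.exp w‖ ≤ 1 := by rw [Complex.norm_exp]; exact Real.exp_le_one_iff.2 hw
    have h2 := norm_sub_le (Complex.exp w) 1
    rw [norm_one] at h2
    linarith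

theorem norm_exp_sub_one_sub_id_le_of_re_nonpos {w : ℂ} (hw : w.re ≤ 0) :
    ‖Complex.exp w - 1 - w‖ ≤ 3 * ‖w‖ ^ 2 := by
  rcases le_or_gt ‖w‖ 1 with h | h
  · exact (Complex.norm_exp_sub_one_sub_id_le h).trans (by nlinarith [sq_nonneg ‖w‖])
  · have h2 := norm_sub_le (Complex.exp w - 1) w
    have h3 := norm_exp_sub_one_le_of_re_nonpos hw
    nlinarith

/-- The integrand of the jump part of a Laplace exponent. -/
def levyIntegrand (z : ℂ) (r : ℝ) : ℂ :=
  Complex.exp (z * r) - 1 - if |r| ≤ 1 then z * r else 0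

theorem measurable_levyIntegrand (z : ℂ) : Measurable (levyIntegrand z) := by
  unfold levyIntegrand
  refine Measurable.sub (by fun_prop) (Measurable.ite ?_ (by fun_prop) measurable_const)
  exact measurableSet_le (by fun_prop) (by fun_prop)

theorem norm_levyIntegrand_le {z : ℂ} (hz : 0 ≤ z.re) {r : ℝ} (hr : r < 0) :
    ‖levyIntegrand z r‖ ≤ (3 * ‖z‖ ^ 2 + 2) * min 1 (r ^ 2) := by
  have hw : (z * r).re ≤ 0 := by
    rw [Complex.re_mul_ofReal]; exact mul_nonpos_of_nonneg_of_nonpos hz hr.le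
  unfold levyIntegrand
  split_ifs with h
  · rw [min_eq_right ((sq_le_one_iff_abs_le_one r).2 h)]
    refine (norm_exp_sub_one_sub_id_le_of_re_nonpos hw).trans ?_
    rw [norm_mul, Complex.norm_real, mul_pow, Real.norm_eq_abs, sq_abs]
    nlinarith [sq_nonneg r]
  · rw [min_eq_left ((one_le_sq_iff_one_le_abs r).2 (not_le.1 h).le), sub_zero]
    have h1 : ‖Complex.exp (z * r)‖ ≤ 1 := by
      rw [Complex.norm_exp]; exact Real.exp_le_one_iff.2 hw
    have h2 := norm_sub_le (Complex.exp (z * r)) 1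
    rw [norm_one] at h2
    nlinarith [sq_nonneg ‖z‖]

/-- The jump part of a Laplace exponent. -/
def levyJump (P : Measure ℝ) (z : ℂ) : ℂ := ∫ r, levyIntegrand z r ∂P

theorem integrable_levyIntegrand {P : Measure ℝ} (hneg : ∀ᵐ r ∂P, r < 0)
    (hP : Integrable (fun r : ℝ => min 1 (r ^ 2)) P) {z : ℂ} (hz : 0 ≤ z.re) :
    Integrable (levyIntegrand z) P :=
  (hP.const_mul (3 * ‖z‖ ^ 2 + 2)).mono' (measurable_levyIntegrand z).aestronglyMeasurable
    (hneg.mono fun _ hr => norm_levyIntegrand_le hz hr)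

/-- The derivative of the integrand of the jump part of a Laplace exponent. -/
def levyIntegrandDeriv (z : ℂ) (r : ℝ) : ℂ :=
  (Complex.exp (z * r) - if |r| ≤ 1 then 1 else 0) * r

theorem measurable_levyIntegrandDeriv (z : ℂ) : Measurable (levyIntegrandDeriv z) := by
  unfold levyIntegrandDeriv
  refine Measurable.mul (Measurable.sub (by fun_prop) (Measurable.ite ?_ measurable_const
    measurable_const)) (by fun_prop)
  exact measurableSet_le (by fun_prop) (by fun_prop)

theorem hasDerivAt_levyIntegrand (z : ℂ) (r : ℝ) :
    HasDerivAt (fun z => levyIntegrand z r) (levyIntegrandDeriv z r) z := by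
  unfold levyIntegrand levyIntegrandDeriv
  have h1 : HasDerivAt (fun z : ℂ => z * r) (r : ℂ) z := by
    simpa using (hasDerivAt_id z).mul_const (r : ℂ)
  rw [sub_mul]
  refine HasDerivAt.sub (h1.cexp.sub_const 1) ?_
  split_ifs
  · simpa using h1
  · simpa using hasDerivAt_const z (0 : ℂ)

theorem norm_levyIntegrandDeriv_le {z : ℂ} {ε M : ℝ} (hε : 0 < ε) (hz : ε ≤ z.re)
    (hM : ‖z‖ ≤ M) {r : ℝ} (hr : r < 0) :
    ‖levyIntegrandDeriv z r‖ ≤ (2 * M + 1 / ε) * min 1 (r ^ 2) := by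
  have hM0 : 0 ≤ M := (norm_nonneg z).trans hM
  have hw : (z * r).re ≤ 0 := by
    rw [Complex.re_mul_ofReal]; exact mul_nonpos_of_nonneg_of_nonpos (hε.le.trans hz) hr.le
  unfold levyIntegrandDeriv
  rw [norm_mul, Complex.norm_real, Real.norm_eq_abs]
  have hε' : 0 < 1 / ε := by positivity
  split_ifs with h
  · rw [min_eq_right ((sq_le_one_iff_abs_le_one r).2 h)]
    have h1 := norm_exp_sub_one_le_of_re_nonpos hw
    rw [norm_mul, Complex.norm_real, Real.norm_eq_abs] at h1
    have h2 : 2 * (‖z‖ * |r|) ≤ 2 * (M * |r|) := by gcongr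
    calc _ ≤ 2 * (M * |r|) * |r| := by gcongr; exact h1.trans h2
      _ = 2 * M * r ^ 2 := by rw [← sq_abs r]; ring
      _ ≤ _ := by nlinarith [sq_nonneg r]
  · rw [min_eq_left ((one_le_sq_iff_one_le_abs r).2 (not_le.1 h).le), sub_zero, mul_one,
      Complex.norm_exp, Complex.re_mul_ofReal, abs_of_neg hr]
    have h1 : Real.exp (z.re * r) ≤ Real.exp (ε * r) := Real.exp_le_exp.2 (by nlinarith)
    have h2 : ε * (-r) * Real.exp (ε * r) ≤ 1 := by
      have h3 := Real.add_one_le_exp (-(ε * r))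
      have h4 : Real.exp (-(ε * r)) * Real.exp (ε * r) = 1 := by rw [← Real.exp_add]; simp
      nlinarith [Real.exp_pos (ε * r)]
    calc _ ≤ Real.exp (ε * r) * (-r) := by gcongr; linarith
      _ ≤ 1 / ε := by rw [le_div_iff₀ hε]; linarith
      _ ≤ _ := by linarith

theorem integrable_levyIntegrandDeriv {P : Measure ℝ} (hneg : ∀ᵐ r ∂P, r < 0)
    (hP : Integrable (fun r : ℝ => min 1 (r ^ 2)) P) {z : ℂ} (hz : 0 < z.re) :
    Integrable (levyIntegrandDeriv z) P :=
  (hP.const_mul (2 * ‖z‖ + 1 / z.re)).mono' (measurable_levyIntegrandDeriv z).aestronglyMeasurable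
    (hneg.mono fun _ hr => norm_levyIntegrandDeriv_le hz le_rfl le_rfl hr)

theorem differentiableOn_levyJump {P : Measure ℝ} (hneg : ∀ᵐ r ∂P, r < 0)
    (hP : Integrable (fun r : ℝ => min 1 (r ^ 2)) P) :
    DifferentiableOn ℂ (levyJump P) {z | 0 < z.re} := by
  intro z hz
  have hz : 0 < z.re := hz
  have hball : ∀ w ∈ Metric.ball z (z.re / 2), z.re / 2 ≤ w.re ∧ ‖w‖ ≤ ‖z‖ + z.re / 2 := by
    intro w hw
    rw [Metric.mem_ball, dist_eq_norm] at hw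
    have h1 := (abs_le.1 (Complex.abs_re_le_norm (w - z))).1
    have h2 := norm_le_norm_add_norm_sub' w z
    rw [Complex.sub_re] at h1
    constructor <;> linarith
  refine (hasDerivAt_integral_of_dominated_loc_of_deriv_le (F := fun z r => levyIntegrand z r)
    (F' := fun z r => levyIntegrandDeriv z r)
    (bound := fun r => (2 * (‖z‖ + z.re / 2) + 1 / (z.re / 2)) * min 1 (r ^ 2))
    (Metric.ball_mem_nhds z (half_pos hz)) ?_ ?_ ?_ ?_ ?_
    ?_).2.differentiableAt.differentiableWithinAt
  · exact .of_forall fun w => (measurable_levyIntegrand w).aestronglyMeasurable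
  · exact integrable_levyIntegrand hneg hP hz.le
  · exact (measurable_levyIntegrandDeriv z).aestronglyMeasurable
  · filter_upwards [hneg] with r hr w hw
    exact norm_levyIntegrandDeriv_le (half_pos hz) (hball w hw).1 (hball w hw).2 hr
  · exact hP.const_mul _
  · exact .of_forall fun r w _ => hasDerivAt_levyIntegrand w r

theorem levyJump_ofReal (P : Measure ℝ) (u : ℝ) :
    levyJump P u = ((∫ r, (Real.exp (u * r) - 1 - (if |r| ≤ 1 then u * r else 0)) ∂P : ℝ) : ℂ) := by
  rw [levyJump, ← integral_complex_ofReal]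
  congr 1; ext r
  unfold levyIntegrand
  split_ifs <;> push_cast <;> rfl

theorem integral_levyIntegrandDeriv_ofReal (P : Measure ℝ) (u : ℝ) :
    ∫ r, levyIntegrandDeriv u r ∂P =
      ((∫ r, (Real.exp (u * r) - (if |r| ≤ 1 then 1 else 0)) * r ∂P : ℝ) : ℂ) := by
  rw [← integral_complex_ofReal]
  congr 1; ext r
  unfold levyIntegrandDeriv
  split_ifs <;> push_cast <;> rfl

theorem complexMGF_eq_exp_of_laplace {P : Measure ℝ} (hneg : ∀ᵐ r ∂P, r < 0)
    (hP : Integrable (fun r : ℝ => min 1 (r ^ 2)) P) {b σ t : ℝ} {μ : Measure ℝ}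
    (hexp : ∀ u : ℝ, 0 ≤ u → Integrable (fun y => Real.exp (u * y)) μ)
    (hlap : ∀ u : ℝ, 0 ≤ u → ∫ y, Real.exp (u * y) ∂μ = Real.exp (t * (b * u + σ ^ 2 * u ^ 2 / 2 +
      ∫ r, (Real.exp (u * r) - 1 - (if |r| ≤ 1 then u * r else 0)) ∂P)))
    {z : ℂ} (hz : 0 < z.re) :
    ProbabilityTheory.complexMGF id μ z =
      Complex.exp (t * (b * z + σ ^ 2 * z ^ 2 / 2 + levyJump P z)) := by
  have hopen : IsOpen {z : ℂ | 0 < z.re} := isOpen_lt continuous_const Complex.continuous_re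
  have hsub : ∀ z : ℂ, 0 < z.re →
      z.re ∈ interior (ProbabilityTheory.integrableExpSet (id : ℝ → ℝ) μ) := by
    intro z hz
    refine mem_interior.2 ⟨Ioi 0, fun u hu => hexp u (le_of_lt hu), isOpen_Ioi, hz⟩
  have h1 : AnalyticOnNhd ℂ (ProbabilityTheory.complexMGF id μ) {z : ℂ | 0 < z.re} :=
    fun z hz => ProbabilityTheory.analyticAt_complexMGF (hsub z hz)
  have h2 : AnalyticOnNhd ℂ (fun z : ℂ => Complex.exp (t * (b * z + σ ^ 2 * z ^ 2 / 2 +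
      levyJump P z))) {z : ℂ | 0 < z.re} := by
    refine DifferentiableOn.analyticOnNhd ?_ hopen
    have := differentiableOn_levyJump hneg hP
    fun_prop
  refine h1.eqOn_of_preconnected_of_frequently_eq h2
    (convex_halfSpace_re_gt 0).isPreconnected (z₀ := 1) (by simp) ?_ hz
  have ht : Tendsto (Complex.ofReal) (nhdsWithin 1 {1}ᶜ) (nhdsWithin 1 {1}ᶜ) := by
    refine tendsto_nhdsWithin_of_tendsto_nhds_of_eventually_within _ ?_ ?_
    · exact (Complex.continuous_ofReal.tendsto' 1 1 (by simp)).mono_left nhdsWithin_le_nhds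
    · filter_upwards [self_mem_nhdsWithin] with u hu
      simpa using hu
  refine ht.frequently (Eventually.frequently ?_)
  filter_upwards [mem_nhdsWithin_of_mem_nhds (lt_mem_nhds (zero_lt_one (α := ℝ)))] with u hu
  rw [ProbabilityTheory.complexMGF_ofReal, levyJump_ofReal, ProbabilityTheory.mgf]
  simp only [id]
  rw [hlap u hu.le]
  push_cast
  rfl

/-- The exponentially tilted second order remainder of the jump part of a Laplace exponent. -/
def levyRemainder (P : Measure ℝ) (y s : ℝ) : ℂ :=
  ∫ r : ℝ, Real.exp (y * r) * (Complex.exp (s * r * Complex.I) - 1 - s * r * Complex.I) ∂P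

theorem levyIntegrand_add_sub (y s r : ℝ) :
    levyIntegrand (y + s * Complex.I) r - levyIntegrand y r -
      s * Complex.I * levyIntegrandDeriv y r =
    Real.exp (y * r) * (Complex.exp (s * r * Complex.I) - 1 - s * r * Complex.I) := by
  unfold levyIntegrand levyIntegrandDeriv
  rw [add_mul, Complex.exp_add, mul_right_comm (s : ℂ) Complex.I r]
  push_cast
  split_ifs <;> ring

theorem integrable_levyRemainder {P : Measure ℝ} (hneg : ∀ᵐ r ∂P, r < 0)
    (hP : Integrable (fun r : ℝ => min 1 (r ^ 2)) P) {y : ℝ} (hy : 0 < y) (s : ℝ) :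
    Integrable (fun r : ℝ => (Real.exp (y * r) : ℂ) *
      (Complex.exp (s * r * Complex.I) - 1 - s * r * Complex.I)) P := by
  simp_rw [← levyIntegrand_add_sub]
  exact ((integrable_levyIntegrand hneg hP (by simpa using hy.le)).sub
    (integrable_levyIntegrand hneg hP (by simpa using hy.le))).sub
    ((integrable_levyIntegrandDeriv hneg hP (by simpa using hy)).const_mul _)

theorem levyJump_add_mul_I {P : Measure ℝ} (hneg : ∀ᵐ r ∂P, r < 0)
    (hP : Integrable (fun r : ℝ => min 1 (r ^ 2)) P) {y : ℝ} (hy : 0 < y) (s : ℝ) :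
    levyJump P (y + s * Complex.I) = levyJump P y +
      s * Complex.I * ∫ r, levyIntegrandDeriv y r ∂P + levyRemainder P y s := by
  have h1 := integrable_levyIntegrand hneg hP (z := y + s * Complex.I) (by simpa using hy.le)
  have h2 := integrable_levyIntegrand hneg hP (z := y) (by simpa using hy.le)
  have h3 := integrable_levyIntegrandDeriv hneg hP (z := y) (by simpa using hy)
  unfold levyRemainder levyJump
  simp_rw [← levyIntegrand_add_sub]
  have h := integral_sub (h1.sub h2) (h3.const_mul (s * Complex.I))
  simp only [Pi.sub_apply] at h
  rw [h, integral_sub h1 h2, integral_const_mul]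
  ring

theorem re_levyRemainder_nonpos {P : Measure ℝ} (hneg : ∀ᵐ r ∂P, r < 0)
    (hP : Integrable (fun r : ℝ => min 1 (r ^ 2)) P) {y : ℝ} (hy : 0 < y) (s : ℝ) :
    (levyRemainder P y s).re ≤ 0 := by
  unfold levyRemainder
  rw [← RCLike.re_eq_complex_re, ← integral_re (integrable_levyRemainder hneg hP hy s)]
  refine integral_nonpos fun r => ?_
  simp only [RCLike.re_eq_complex_re, Pi.zero_apply]
  rw [Complex.re_ofReal_mul]
  refine mul_nonpos_of_nonneg_of_nonpos (Real.exp_pos _).le ?_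
  have h : (Complex.exp (s * r * Complex.I)).re = Real.cos (s * r) := by
    rw [← Complex.ofReal_mul, Complex.exp_ofReal_mul_I_re]
  have h' : ((s : ℂ) * r * Complex.I).re = 0 := by rw [← Complex.ofReal_mul]; simp
  rw [Complex.sub_re, Complex.sub_re, h, h', Complex.one_re]
  linarith [Real.cos_le_one (s * r)]

theorem sq_mul_exp_le {r : ℝ} (hr : r < 0) : r ^ 2 * Real.exp r ≤ 2 * min 1 (r ^ 2) := by
  have h1 : r ^ 2 * Real.exp r ≤ r ^ 2 :=
    mul_le_of_le_one_right (sq_nonneg r) (Real.exp_le_one_iff.2 hr.le)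
  have h2 := Real.quadratic_le_exp_of_nonneg (x := -r) (by linarith)
  have h3 : Real.exp (-r) * Real.exp r = 1 := by rw [← Real.exp_add]; simp
  rcases le_total 1 (r ^ 2) with h | h
  · rw [min_eq_left h]; nlinarith [Real.exp_pos r]
  · rw [min_eq_right h]; nlinarith [sq_nonneg r]

theorem tendsto_levyRemainder {P : Measure ℝ} (hneg : ∀ᵐ r ∂P, r < 0)
    (hP : Integrable (fun r : ℝ => min 1 (r ^ 2)) P) (s : ℝ) :
    Tendsto (fun y => levyRemainder P y s) atTop (nhds 0) := by
  rw [← integral_zero ℝ ℂ (μ := P)]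
  refine tendsto_integral_filter_of_dominated_convergence
    (fun r => 6 * s ^ 2 * min 1 (r ^ 2)) ?_ ?_ (hP.const_mul _) ?_
  · exact .of_forall fun y => (Continuous.aestronglyMeasurable (by fun_prop))
  · filter_upwards [eventually_ge_atTop 1] with y hy
    filter_upwards [hneg] with r hr
    have h1 := norm_exp_sub_one_sub_id_le_of_re_nonpos (w := s * r * Complex.I)
      (by rw [← Complex.ofReal_mul]; simp)
    have h2 : ‖(s * r * Complex.I : ℂ)‖ ^ 2 = s ^ 2 * r ^ 2 := by
      simp [mul_pow]
    rw [h2] at h1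
    rw [norm_mul, Complex.norm_real, Real.norm_of_nonneg (Real.exp_pos _).le]
    have h3 : Real.exp (y * r) ≤ Real.exp r := Real.exp_le_exp.2 (by nlinarith)
    calc _ ≤ Real.exp r * (3 * (s ^ 2 * r ^ 2)) := by gcongr
      _ = 3 * s ^ 2 * (r ^ 2 * Real.exp r) := by ring
      _ ≤ 3 * s ^ 2 * (2 * min 1 (r ^ 2)) :=
          mul_le_mul_of_nonneg_left (sq_mul_exp_le hr) (by positivity)
      _ = _ := by ring
  · filter_upwards [hneg] with r hr
    have h : Tendsto (fun y : ℝ => Real.exp (y * r)) atTop (nhds 0) :=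
      Real.tendsto_exp_atBot.comp (tendsto_id.atTop_mul_const_of_neg hr)
    have h' := ((Complex.continuous_ofReal.tendsto 0).comp h).mul_const
      (Complex.exp (s * r * Complex.I) - 1 - s * r * Complex.I)
    simpa using h'

theorem charFun_tilted_mul (μ : Measure ℝ) (y s : ℝ) :
    charFun (μ.tilted fun x => y * x) s =
      (ProbabilityTheory.mgf id μ y : ℂ)⁻¹ * ProbabilityTheory.complexMGF id μ (y + s * Complex.I) := by
  rw [charFun_apply_real, integral_tilted, ProbabilityTheory.complexMGF, ← integral_const_mul]
  congr 1; ext x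
  simp only [ProbabilityTheory.mgf, id]
  rw [Complex.real_smul, add_mul, Complex.exp_add]
  push_cast
  rw [mul_right_comm (s : ℂ) Complex.I x]
  ring

theorem charFun_tilted_eq_exp {P : Measure ℝ} (hneg : ∀ᵐ r ∂P, r < 0)
    (hP : Integrable (fun r : ℝ => min 1 (r ^ 2)) P) {b σ t : ℝ} {μ : Measure ℝ}
    (hexp : ∀ u : ℝ, 0 ≤ u → Integrable (fun y => Real.exp (u * y)) μ)
    (hlap : ∀ u : ℝ, 0 ≤ u → ∫ y, Real.exp (u * y) ∂μ = Real.exp (t * (b * u + σ ^ 2 * u ^ 2 / 2 +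
      ∫ r, (Real.exp (u * r) - 1 - (if |r| ≤ 1 then u * r else 0)) ∂P)))
    {y : ℝ} (hy : 0 < y) (s : ℝ) :
    charFun (μ.tilted fun x => y * x) s =
      Complex.exp (s * (t * (b + σ ^ 2 * y +
        ∫ r, (Real.exp (y * r) - (if |r| ≤ 1 then 1 else 0)) * r ∂P) : ℝ) * Complex.I) *
      Complex.exp (-(t * σ ^ 2 / 2 * s ^ 2 : ℝ) + t * levyRemainder P y s) := by
  rw [charFun_tilted_mul, ← ProbabilityTheory.complexMGF_ofReal,
    complexMGF_eq_exp_of_laplace hneg hP hexp hlap (z := y) (by simpa using hy),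
    complexMGF_eq_exp_of_laplace hneg hP hexp hlap (z := y + s * Complex.I) (by simpa using hy),
    levyJump_add_mul_I hneg hP hy, integral_levyIntegrandDeriv_ofReal, ← Complex.exp_neg,
    ← Complex.exp_add, ← Complex.exp_add]
  congr 1
  push_cast
  linear_combination (t * σ ^ 2 * s ^ 2 / 2 : ℂ) * Complex.I_sq

theorem norm_exp_gaussian_add_levyRemainder_le {P : Measure ℝ} (hneg : ∀ᵐ r ∂P, r < 0)
    (hP : Integrable (fun r : ℝ => min 1 (r ^ 2)) P) {σ t : ℝ} (ht : 0 < t)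
    {y : ℝ} (hy : 0 < y) (s : ℝ) :
    ‖Complex.exp (-(t * σ ^ 2 / 2 * s ^ 2 : ℝ) + t * levyRemainder P y s)‖ ≤
      Real.exp (-(t * σ ^ 2 / 2) * s ^ 2) := by
  rw [Complex.norm_exp, Real.exp_le_exp, Complex.add_re, Complex.re_ofReal_mul, Complex.neg_re,
    Complex.ofReal_re]
  nlinarith [re_levyRemainder_nonpos hneg hP hy s]

theorem integrable_charFun_tilted {P : Measure ℝ} (hneg : ∀ᵐ r ∂P, r < 0)
    (hP : Integrable (fun r : ℝ => min 1 (r ^ 2)) P) {b σ t : ℝ} (hσ : 0 < σ) (ht : 0 < t)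
    {μ : Measure ℝ} [IsFiniteMeasure μ]
    (hexp : ∀ u : ℝ, 0 ≤ u → Integrable (fun y => Real.exp (u * y)) μ)
    (hlap : ∀ u : ℝ, 0 ≤ u → ∫ y, Real.exp (u * y) ∂μ = Real.exp (t * (b * u + σ ^ 2 * u ^ 2 / 2 +
      ∫ r, (Real.exp (u * r) - 1 - (if |r| ≤ 1 then u * r else 0)) ∂P)))
    {y : ℝ} (hy : 0 < y) :
    Integrable (charFun (μ.tilted fun x => y * x)) := by
  refine (integrable_exp_neg_mul_sq (b := t * σ ^ 2 / 2) (by positivity)).mono'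
    stronglyMeasurable_charFun.aestronglyMeasurable (.of_forall fun s => ?_)
  rw [charFun_tilted_eq_exp hneg hP hexp hlap hy, norm_mul, ← Complex.ofReal_mul,
    Complex.norm_exp_ofReal_mul_I, one_mul]
  exact norm_exp_gaussian_add_levyRemainder_le hneg hP ht hy s

theorem tendsto_charFunDensity_tilted {P : Measure ℝ} (hneg : ∀ᵐ r ∂P, r < 0)
    (hP : Integrable (fun r : ℝ => min 1 (r ^ 2)) P) {b σ t : ℝ} (hσ : 0 < σ) (ht : 0 < t)
    {μ : Measure ℝ} [IsFiniteMeasure μ]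
    (hexp : ∀ u : ℝ, 0 ≤ u → Integrable (fun y => Real.exp (u * y)) μ)
    (hlap : ∀ u : ℝ, 0 ≤ u → ∫ y, Real.exp (u * y) ∂μ = Real.exp (t * (b * u + σ ^ 2 * u ^ 2 / 2 +
      ∫ r, (Real.exp (u * r) - 1 - (if |r| ≤ 1 then u * r else 0)) ∂P))) :
    Tendsto (fun y => charFunDensity (μ.tilted fun x => y * x) (t * (b + σ ^ 2 * y +
        ∫ r, (Real.exp (y * r) - (if |r| ≤ 1 then 1 else 0)) * r ∂P))) atTop
      (nhds (Real.sqrt (2 * Real.pi * σ ^ 2 * t))⁻¹) := by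
  have hpos : 0 < t * σ ^ 2 / 2 := by positivity
  have hcancel : ∀ y : ℝ, 0 < y → ∀ s : ℝ,
      Complex.exp (-(s * (t * (b + σ ^ 2 * y +
        ∫ r, (Real.exp (y * r) - (if |r| ≤ 1 then 1 else 0)) * r ∂P) : ℝ) * Complex.I)) *
        charFun (μ.tilted fun x => y * x) s =
      Complex.exp (-(t * σ ^ 2 / 2 * s ^ 2 : ℝ) + t * levyRemainder P y s) := by
    intro y hy s
    rw [charFun_tilted_eq_exp hneg hP hexp hlap hy, ← mul_assoc, ← Complex.exp_add,
      neg_add_cancel, Complex.exp_zero, one_mul]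
  have hlim : Tendsto (fun y => ∫ s : ℝ, Complex.exp (-(s * (t * (b + σ ^ 2 * y +
        ∫ r, (Real.exp (y * r) - (if |r| ≤ 1 then 1 else 0)) * r ∂P) : ℝ) * Complex.I)) *
        charFun (μ.tilted fun x => y * x) s) atTop
      (nhds (∫ s : ℝ, ((Real.exp (-(t * σ ^ 2 / 2) * s ^ 2) : ℝ) : ℂ))) := by
    refine tendsto_integral_filter_of_dominated_convergence
      (fun s => Real.exp (-(t * σ ^ 2 / 2) * s ^ 2)) ?_ ?_ (integrable_exp_neg_mul_sq hpos) ?_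
    · exact .of_forall fun y => (Continuous.aestronglyMeasurable (by fun_prop)).mul
        stronglyMeasurable_charFun.aestronglyMeasurable
    · filter_upwards [eventually_gt_atTop 0] with y hy
      refine .of_forall fun s => ?_
      rw [hcancel y hy]
      exact norm_exp_gaussian_add_levyRemainder_le hneg hP ht hy s
    · refine .of_forall fun s => ?_
      have h := ((tendsto_levyRemainder hneg hP s).const_mul (t : ℂ)).const_add
        (-(t * σ ^ 2 / 2 * s ^ 2 : ℝ) : ℂ)
      have h' := (Complex.continuous_exp.tendsto _).comp h
      rw [mul_zero, add_zero, ← Complex.ofReal_neg, ← Complex.ofReal_exp, ← neg_mul] at h'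
      refine h'.congr' ?_
      filter_upwards [eventually_gt_atTop 0] with y hy
      rw [hcancel y hy s, neg_mul, Complex.ofReal_neg]
      rfl
  have h := (Complex.continuous_re.tendsto _).comp (hlim.const_mul ((2 * Real.pi)⁻¹ : ℂ))
  convert h using 2
  · simp [charFunDensity]
  · rw [integral_complex_ofReal, integral_gaussian, ← Complex.ofReal_ofNat, ← Complex.ofReal_mul,
      ← Complex.ofReal_inv, ← Complex.ofReal_mul, Complex.ofReal_re]
    have hpi := Real.pi_pos
    have e : Real.pi / (t * σ ^ 2 / 2) = (2 * Real.pi) ^ 2 / (2 * Real.pi * σ ^ 2 * t) := by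
      field_simp
    rw [e, Real.sqrt_div (by positivity), Real.sqrt_sq (by positivity), ← mul_div_assoc,
      inv_mul_cancel₀ (by positivity), one_div]

theorem eq_withDensity_exp_mul_charFunDensity_tilted
    (μ : Measure ℝ) [IsProbabilityMeasure μ] {y : ℝ}
    (hexp : Integrable (fun x => Real.exp (y * x)) μ)
    (hint : Integrable (charFun (μ.tilted fun x => y * x))) :
    μ = volume.withDensity fun x => ENNReal.ofReal
      ((∫ x, Real.exp (y * x) ∂μ) * Real.exp (-(y * x)) *
        charFunDensity (μ.tilted fun x => y * x) x) := by
  have h := tilted_neg_same hexp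
  have hZ : ∫ x, Real.exp ((-fun x => y * x) x) ∂(μ.tilted fun x => y * x) =
      (∫ x, Real.exp (y * x) ∂μ)⁻¹ := by
    rw [integral_exp_tilted]
    simp
  conv_lhs => rw [← h, Measure.tilted, hZ, eq_withDensity_charFunDensity _ hint]
  rw [← withDensity_mul]
  · congr 1; ext x
    simp only [Pi.mul_apply, Pi.neg_apply, div_inv_eq_mul]
    rw [← ENNReal.ofReal_mul (charFunDensity_nonneg _ hint x)]
    congr 1; ring
  · exact (continuous_charFunDensity hint).measurable.ennreal_ofReal
  · fun_prop

theorem lintegral_Ioo_neg_mul_exp {y : ℝ} {r : ℝ} (hr : r ≤ 0) :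
    ∫⁻ s in Ioo r 0, ENNReal.ofReal (-(y ^ 2 * (s * Real.exp (y * s)))) =
      ENNReal.ofReal (1 + y * r * Real.exp (y * r) - Real.exp (y * r)) := by
  have hc : Continuous fun s => -(y ^ 2 * (s * Real.exp (y * s))) := by fun_prop
  have hd : ∀ s ∈ uIcc r 0, HasDerivAt (fun s => Real.exp (y * s) - y * s * Real.exp (y * s))
      (-(y ^ 2 * (s * Real.exp (y * s)))) s := by
    intro s _
    have h1 : HasDerivAt (fun s => y * s) y s := by simpa using (hasDerivAt_id s).const_mul y
    exact (h1.exp.sub (h1.mul h1.exp)).congr_deriv (by ring)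
  have h := intervalIntegral.integral_eq_sub_of_hasDerivAt hd (hc.intervalIntegrable _ _)
  rw [intervalIntegral.integral_of_le hr, integral_Ioc_eq_integral_Ioo] at h
  rw [← ofReal_integral_eq_lintegral_ofReal, h]
  · congr 1; simp; ring
  · exact (hc.integrableOn_Icc).mono_set Ioo_subset_Icc_self
  · filter_upwards [ae_restrict_mem measurableSet_Ioo] with s hs
    have := mul_nonneg (neg_nonneg.2 hs.2.le) (Real.exp_pos (y * s)).le
    simp only [Pi.zero_apply]
    nlinarith [sq_nonneg y]

theorem measure_Iio_lt_top {P : Measure ℝ}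
    (hP : Integrable (fun r : ℝ => min 1 (r ^ 2)) P) {s : ℝ} (hs : s < 0) :
    P (Iio s) < ⊤ := by
  refine (measure_mono fun r hr => ?_).trans_lt
    (hP.measure_ge_lt_top (ε := min 1 (s ^ 2)) (by have := sq_pos_of_neg hs; positivity))
  have hr : r < s := hr
  exact min_le_min le_rfl (by nlinarith : s ^ 2 ≤ r ^ 2)

theorem integral_second_order_eq_sq_mul_integral_tail {P : Measure ℝ} [SFinite P]
    (hneg : ∀ᵐ r ∂P, r < 0) (hP : Integrable (fun r : ℝ => min 1 (r ^ 2)) P) (y : ℝ) :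
    ∫ r, (Real.exp (y * r) - 1 - y * r * Real.exp (y * r)) ∂P =
      y ^ 2 * ∫ s in Iio (0 : ℝ), Real.exp (y * s) * s * (P (Iio s)).toReal := by
  have hmono : Monotone fun s => P (Iio s) := fun _ _ h => measure_mono (Iio_subset_Iio h)
  have hm : Measurable fun s : ℝ => P (Iio s) := hmono.measurable
  have key : ∫⁻ r, ENNReal.ofReal (1 + y * r * Real.exp (y * r) - Real.exp (y * r)) ∂P =
      ∫⁻ s in Iio (0 : ℝ), ENNReal.ofReal
        (-(y ^ 2 * (Real.exp (y * s) * s * (P (Iio s)).toReal))) := by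
    have h1 : ∀ r : ℝ, r < 0 →
        ENNReal.ofReal (1 + y * r * Real.exp (y * r) - Real.exp (y * r)) =
        ∫⁻ s in Iio (0 : ℝ), {p : ℝ × ℝ | p.1 < p.2}.indicator
          (fun p => ENNReal.ofReal (-(y ^ 2 * (p.2 * Real.exp (y * p.2))))) (r, s) := by
      intro r hr
      rw [← lintegral_Ioo_neg_mul_exp hr.le, ← Ioi_inter_Iio, ← Measure.restrict_restrict
        measurableSet_Ioi, ← lintegral_indicator measurableSet_Ioi]
      rfl
    rw [lintegral_congr_ae (hneg.mono h1), lintegral_lintegral_swap]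
    · refine setLIntegral_congr_fun measurableSet_Iio fun s hs => ?_
      have hs : s < 0 := hs
      have h2 : ∀ r : ℝ, {p : ℝ × ℝ | p.1 < p.2}.indicator
          (fun p => ENNReal.ofReal (-(y ^ 2 * (p.2 * Real.exp (y * p.2))))) (r, s) =
          (Iio s).indicator (fun _ => ENNReal.ofReal (-(y ^ 2 * (s * Real.exp (y * s))))) r :=
        fun r => rfl
      simp only [h2]
      rw [lintegral_indicator_const measurableSet_Iio,
        ← ENNReal.ofReal_toReal (measure_Iio_lt_top hP hs).ne, ← ENNReal.ofReal_mul]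
      · rw [ENNReal.toReal_ofReal ENNReal.toReal_nonneg]
        congr 1; ring
      · have := mul_nonneg (neg_nonneg.2 hs.le) (Real.exp_pos (y * s)).le
        nlinarith [sq_nonneg y]
    · refine Measurable.aemeasurable (Measurable.indicator ?_ ?_)
      · fun_prop
      · exact measurableSet_lt measurable_fst measurable_snd
  have hL : ∫ r, (1 + y * r * Real.exp (y * r) - Real.exp (y * r)) ∂P =
      ∫ s in Iio (0 : ℝ), (-(y ^ 2 * (Real.exp (y * s) * s * (P (Iio s)).toReal))) := by
    rw [integral_eq_lintegral_of_nonneg_ae, key, integral_eq_lintegral_of_nonneg_ae]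
    · filter_upwards [ae_restrict_mem measurableSet_Iio] with s hs
      have hs : s < 0 := hs
      have h1 := mul_nonneg (mul_nonneg (neg_nonneg.2 hs.le) (Real.exp_pos (y * s)).le)
        (ENNReal.toReal_nonneg (a := P (Iio s)))
      simp only [Pi.zero_apply]
      nlinarith [sq_nonneg y]
    · exact Measurable.aestronglyMeasurable (by have := hm.ennreal_toReal; fun_prop)
    · refine .of_forall fun r => ?_
      have h1 := Real.add_one_le_exp (-(y * r))
      have h2 : Real.exp (-(y * r)) * Real.exp (y * r) = 1 := by rw [← Real.exp_add]; simp
      simp only [Pi.zero_apply]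
      nlinarith [Real.exp_pos (y * r)]
    · exact Continuous.aestronglyMeasurable (by fun_prop)
  rw [integral_neg, integral_const_mul] at hL
  rw [← neg_eq_iff_eq_neg.2 hL, ← integral_neg]
  congr 1; ext r; ring

theorem laplaceExponent_sub_mul_deriv {P : Measure ℝ} [SFinite P] (hneg : ∀ᵐ r ∂P, r < 0)
    (hP : Integrable (fun r : ℝ => min 1 (r ^ 2)) P) (b σ : ℝ) {y : ℝ} (hy : 0 < y) :
    (b * y + σ ^ 2 * y ^ 2 / 2 +
      ∫ r, (Real.exp (y * r) - 1 - (if |r| ≤ 1 then y * r else 0)) ∂P) -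
      y * (b + σ ^ 2 * y + ∫ r, (Real.exp (y * r) - (if |r| ≤ 1 then 1 else 0)) * r ∂P) =
    -(σ ^ 2 * y ^ 2) / 2 +
      y ^ 2 * ∫ s in Iio (0 : ℝ), Real.exp (y * s) * s * (P (Iio s)).toReal := by
  have h1 : Integrable (fun r => Real.exp (y * r) - 1 - (if |r| ≤ 1 then y * r else 0)) P := by
    refine (integrable_levyIntegrand hneg hP (z := y) (by simpa using hy.le)).re.congr
      (.of_forall fun r => ?_)
    unfold levyIntegrand
    simp only [RCLike.re_eq_complex_re]
    rw [← Complex.ofReal_re (Real.exp (y * r) - 1 - (if |r| ≤ 1 then y * r else 0))]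
    congr 1
    split_ifs <;> push_cast <;> rfl
  have h2 : Integrable (fun r => (Real.exp (y * r) - (if |r| ≤ 1 then 1 else 0)) * r) P := by
    refine (integrable_levyIntegrandDeriv hneg hP (z := y) (by simpa using hy)).re.congr
      (.of_forall fun r => ?_)
    unfold levyIntegrandDeriv
    simp only [RCLike.re_eq_complex_re]
    rw [← Complex.ofReal_re ((Real.exp (y * r) - (if |r| ≤ 1 then 1 else 0)) * r)]
    congr 1
    split_ifs <;> push_cast <;> rfl
  have h3 := integral_sub h1 (h2.const_mul y)
  rw [integral_const_mul] at h3
  have h4 : ∀ r : ℝ, Real.exp (y * r) - 1 - (if |r| ≤ 1 then y * r else 0) -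
      y * ((Real.exp (y * r) - (if |r| ≤ 1 then 1 else 0)) * r) =
      Real.exp (y * r) - 1 - y * r * Real.exp (y * r) := by
    intro r; split_ifs <;> ring
  simp only [h4] at h3
  rw [integral_second_order_eq_sq_mul_integral_tail hneg hP y] at h3
  linear_combination -h3

/-- **Corollary 2.2**: large asymptotic behavior of the density of a spectrally-negative
Lévy process with Gaussian component: `μ = Law(Y_t)` has a continuous density `f_t` and
`f_t(tΨ'(y)) ∼ (2πσ²t)^{-1/2} exp(-tσ²y²/2 + ty² ∫_{-∞}^0 e^{yr} r Π((-∞,r)) dr)`. -/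
theorem spectrally_negative_density_asymptotics
    (b σ : ℝ) (hσ : 0 < σ)
    (Pim : Measure ℝ) [SigmaFinite Pim] (hPi0 : Pim {0} = 0)
    (hPipos : Pim (Ioi (0:ℝ)) = 0)
    (hPiint : ∫⁻ r, ENNReal.ofReal (min 1 (r ^ 2)) ∂Pim < ⊤)
    (Ψ : ℝ → ℝ)
    (hΨ : ∀ u : ℝ, 0 ≤ u → Ψ u = b * u + σ ^ 2 * u ^ 2 / 2 +
      ∫ r in Iio (0:ℝ), (Real.exp (u * r) - 1 - (if |r| ≤ 1 then u * r else 0)) ∂Pim)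
    (Ψ' : ℝ → ℝ)
    (hΨ' : ∀ y : ℝ, Ψ' y = b + σ ^ 2 * y +
      ∫ r in Iio (0:ℝ), (Real.exp (y * r) - (if |r| ≤ 1 then 1 else 0)) * r ∂Pim)
    (t : ℝ) (ht : 0 < t)
    (μ : Measure ℝ) [IsProbabilityMeasure μ]
    (hexp : ∀ u : ℝ, 0 ≤ u → Integrable (fun y => Real.exp (u * y)) μ)
    (hlap : ∀ u : ℝ, 0 ≤ u → ∫ y, Real.exp (u * y) ∂μ = Real.exp (t * Ψ u)) :
    ∃ f : ℝ → ℝ, Continuous f ∧ (∀ y : ℝ, 0 ≤ f y) ∧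
      μ = volume.withDensity (fun y => ENNReal.ofReal (f y)) ∧
      Tendsto (fun y : ℝ => f (t * Ψ' y) /
        ((Real.sqrt (2 * Real.pi * σ ^ 2 * t))⁻¹ *
          Real.exp (-(t * σ ^ 2 * y ^ 2) / 2 +
            t * y ^ 2 * ∫ r in Iio (0:ℝ), Real.exp (y * r) * r * (Pim (Iio r)).toReal)))
        atTop (nhds 1) := by
  set P := Pim.restrict (Iio 0) with hPdef
  have hneg : ∀ᵐ r ∂P, r < 0 := ae_restrict_mem measurableSet_Iio
  have hP : Integrable (fun r : ℝ => min 1 (r ^ 2)) P := by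
    refine Integrable.mono_measure ?_ Measure.restrict_le_self
    refine ⟨(by fun_prop : Continuous fun r : ℝ => min 1 (r ^ 2)).aestronglyMeasurable, ?_⟩
    rwa [hasFiniteIntegral_iff_ofReal (.of_forall fun r => le_min zero_le_one (sq_nonneg r))]
  have hlap' : ∀ u : ℝ, 0 ≤ u → ∫ y, Real.exp (u * y) ∂μ =
      Real.exp (t * (b * u + σ ^ 2 * u ^ 2 / 2 +
        ∫ r, (Real.exp (u * r) - 1 - (if |r| ≤ 1 then u * r else 0)) ∂P)) := by
    intro u hu
    rw [hlap u hu, hΨ u hu]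
  have htail : ∀ y : ℝ, ∫ r in Iio (0:ℝ), Real.exp (y * r) * r * (P (Iio r)).toReal =
      ∫ r in Iio (0:ℝ), Real.exp (y * r) * r * (Pim (Iio r)).toReal := by
    intro y
    refine setIntegral_congr_fun measurableSet_Iio fun r hr => ?_
    simp only [hPdef]
    rw [Measure.restrict_apply measurableSet_Iio,
      inter_eq_left.2 (Iio_subset_Iio (le_of_lt hr))]
  let F : ℝ → ℝ → ℝ := fun y x => (∫ x, Real.exp (y * x) ∂μ) * Real.exp (-(y * x)) *
    charFunDensity (μ.tilted fun x => y * x) x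
  have hint : ∀ y : ℝ, 0 < y → Integrable (charFun (μ.tilted fun x => y * x)) :=
    fun y hy => integrable_charFun_tilted hneg hP hσ ht hexp hlap' hy
  have hFc : ∀ y : ℝ, 0 < y → Continuous (F y) := fun y hy => by
    have := continuous_charFunDensity (hint y hy)
    fun_prop
  have hF0 : ∀ y : ℝ, 0 < y → ∀ x, 0 ≤ F y x := fun y hy x =>
    mul_nonneg (mul_nonneg (integral_nonneg fun x => (Real.exp_pos _).le) (Real.exp_pos _).le)
      (charFunDensity_nonneg _ (hint y hy) x)
  have hFμ : ∀ y : ℝ, 0 < y → μ = volume.withDensity fun x => ENNReal.ofReal (F y x) :=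
    fun y hy => eq_withDensity_exp_mul_charFunDensity_tilted μ (hexp y hy.le) (hint y hy)
  have hFeq : ∀ y : ℝ, 0 < y → F 1 = F y := by
    intro y hy
    have h := (hFμ 1 one_pos).symm.trans (hFμ y hy)
    rw [withDensity_eq_iff_of_sigmaFinite
      (hFc 1 one_pos).measurable.ennreal_ofReal.aemeasurable
      (hFc y hy).measurable.ennreal_ofReal.aemeasurable] at h
    refine ((hFc 1 one_pos).ae_eq_iff_eq volume (hFc y hy)).1 (h.mono fun x hx => ?_)
    exact (ENNReal.ofReal_eq_ofReal_iff (hF0 1 one_pos x) (hF0 y hy x)).1 hx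
  refine ⟨F 1, hFc 1 one_pos, hF0 1 one_pos, hFμ 1 one_pos, ?_⟩
  have hC : (Real.sqrt (2 * Real.pi * σ ^ 2 * t))⁻¹ ≠ 0 := by
    have := Real.pi_pos
    positivity
  have hlim := (tendsto_charFunDensity_tilted hneg hP hσ ht hexp hlap').div_const
    (Real.sqrt (2 * Real.pi * σ ^ 2 * t))⁻¹
  rw [div_self hC] at hlim
  refine hlim.congr' ?_
  filter_upwards [eventually_gt_atTop 0] with y hy
  have hE : t * Ψ y + -(y * (t * Ψ' y)) = -(t * σ ^ 2 * y ^ 2) / 2 +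
      t * y ^ 2 * ∫ r in Iio (0:ℝ), Real.exp (y * r) * r * (Pim (Iio r)).toReal := by
    have h := laplaceExponent_sub_mul_deriv hneg hP b σ hy
    rw [htail y] at h
    rw [hΨ y hy.le, hΨ' y]
    linear_combination t * h
  rw [hFeq y hy, ← hE, ← hΨ' y]
  simp only [F]
  rw [hlap y hy.le, ← Real.exp_add, mul_comm (Real.exp _), mul_div_mul_right _ _ (Real.exp_pos _).ne']
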